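/- arXiv:0907.2547 — 3 statements merged into one kernel-verified Lean document; each statement's English description precedes it below -/
import Mathlib

section
/- Let (X,G) be a transitive, almost equicontinuous topological dynamical system, and let X₀ be its set of transitive points equipped with the metric d_∞. Then X₀ is G-invariant, G acts on (X₀, d_∞) by isometries with every orbit d_∞-dense in X₀, and the inclusion map (X₀, d_∞) → (X, d) is uniformly continuous, has dense image, and is a homeomorphism onto its image. -/
/-- `x` is an equicontinuous point of the system `(X,G)`. -/
def IsEqctsPt (G : Type*) [Group G] {X : Type*} [MetricSpace X] [MulAction G X] (x : X) : Prop :=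
  ∀ ε > (0 : ℝ), ∃ δ > (0 : ℝ), ∀ y : X, dist x y < δ → ∀ g : G, dist (g • x) (g • y) < ε

/-- The metric `d_∞(x,y) = sup_{g ∈ G} d(g • x, g • y)`. -/
noncomputable def dInfty (G : Type*) [Group G] {X : Type*} [MetricSpace X] [MulAction G X]
    (x y : X) : ℝ :=
  ⨆ g : G, dist (g • x) (g • y)

section

variable {G X : Type*} [Group G] [MetricSpace X] [MulAction G X]

theorem dInfty_comm (x y : X) : dInfty G x y = dInfty G y x := by
  simp only [dInfty, dist_comm]

theorem dInfty_smul_smul (g : G) (x y : X) : dInfty G (g • x) (g • y) = dInfty G x y := by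
  simp only [dInfty, smul_smul]
  exact (Equiv.mulRight g).iSup_comp (g := fun h : G => dist (h • x) (h • y))

theorem dist_le_dInfty [CompactSpace X] (x y : X) : dist x y ≤ dInfty G x y := by
  have hbdd : BddAbove (Set.range fun g : G => dist (g • x) (g • y)) := by
    refine ⟨Metric.diam (Set.univ : Set X), ?_⟩
    rintro _ ⟨g, rfl⟩
    exact Metric.dist_le_diam_of_mem isCompact_univ.isBounded trivial trivial
  simpa [dInfty] using le_ciSup hbdd 1

theorem IsEqctsPt.exists_dInfty_lt {x : X} (hx : IsEqctsPt G x) {ε : ℝ} (hε : 0 < ε) :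
    ∃ δ > (0 : ℝ), ∀ y : X, dist x y < δ → dInfty G x y < ε := by
  obtain ⟨δ, hδ, h⟩ := hx (ε / 2) (half_pos hε)
  exact ⟨δ, hδ, fun y hy => (ciSup_le fun g => (h y hy g).le).trans_lt (half_lt_self hε)⟩

theorem dense_orbit_smul {x : X} (hx : Dense (MulAction.orbit G x)) (g : G) :
    Dense (MulAction.orbit G (g • x)) := by
  rwa [MulAction.orbit_smul]

/-- If some point is equicontinuous, then every transitive point is. -/
theorem IsEqctsPt.of_dense_orbit (hcont : ∀ g : G, Continuous fun x : X => g • x)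
    {x z : X} (hz : IsEqctsPt G z) (hx : Dense (MulAction.orbit G x)) : IsEqctsPt G x := by
  intro ε hε
  obtain ⟨δ, hδ, h⟩ := hz (ε / 2) (half_pos hε)
  obtain ⟨_, ⟨g, rfl⟩, hg⟩ := hx.exists_dist_lt z hδ
  have hopen : IsOpen {y : X | dist z (g • y) < δ} :=
    isOpen_lt (continuous_const.dist (hcont g)) continuous_const
  obtain ⟨η, hη, hball⟩ := Metric.isOpen_iff.1 hopen x hg
  refine ⟨η, hη, fun y hy k => ?_⟩
  have hy' : dist z (g • y) < δ := hball (by rwa [Metric.mem_ball, dist_comm])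
  have hkx := h (g • x) hg (k * g⁻¹)
  have hky := h (g • y) hy' (k * g⁻¹)
  rw [smul_smul, inv_mul_cancel_right] at hkx hky
  linarith [dist_triangle_left (k • x) (k • y) ((k * g⁻¹) • z)]

end

/-- For a transitive, almost equicontinuous system, the set `X₀` of transitive points is
`G`-invariant, `G` acts on `(X₀, d_∞)` by isometries with every orbit `d_∞`-dense, and
the inclusion `(X₀, d_∞) → (X, d)` is uniformly continuous, has dense image, and is a
homeomorphism onto its image (i.e. `d` and `d_∞` induce the same topology on `X₀`). -/
theorem transitive_points_structure
    {G X : Type*} [Group G] [MetricSpace X] [CompactSpace X] [MulAction G X]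
    (hcont : ∀ g : G, Continuous fun x : X => g • x)
    (htrans : ∃ x : X, Dense (MulAction.orbit G x))
    (haeq : Dense {z : X | IsEqctsPt G z}) :
    (∀ (g : G) (x : X), x ∈ {w : X | Dense (MulAction.orbit G w)} →
        g • x ∈ {w : X | Dense (MulAction.orbit G w)}) ∧
    (∀ (g : G) (x y : X), dInfty G (g • x) (g • y) = dInfty G x y) ∧
    (∀ x ∈ {w : X | Dense (MulAction.orbit G w)}, ∀ y ∈ {w : X | Dense (MulAction.orbit G w)},
        ∀ ε > (0 : ℝ), ∃ g : G, dInfty G (g • x) y < ε) ∧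
    (∀ ε > (0 : ℝ), ∃ δ > (0 : ℝ), ∀ x y : X, dInfty G x y < δ → dist x y < ε) ∧
    Dense {w : X | Dense (MulAction.orbit G w)} ∧
    (∀ x ∈ {w : X | Dense (MulAction.orbit G w)}, ∀ ε > (0 : ℝ), ∃ δ > (0 : ℝ),
        ∀ y ∈ {w : X | Dense (MulAction.orbit G w)}, dist x y < δ → dInfty G x y < ε) := by
  obtain ⟨x₀, hx₀⟩ := htrans
  have : Nonempty X := ⟨x₀⟩
  obtain ⟨z, hz : IsEqctsPt G z⟩ := haeq.nonempty
  refine ⟨fun g x hx => dense_orbit_smul hx g, dInfty_smul_smul, ?_,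
    fun ε hε => ⟨ε, hε, fun x y h => (dist_le_dInfty x y).trans_lt h⟩, ?_,
    fun x hx ε hε => ?_⟩
  · intro x hx y hy ε hε
    obtain ⟨δ, hδ, h⟩ := (hz.of_dense_orbit hcont hy).exists_dInfty_lt hε
    obtain ⟨_, ⟨g, rfl⟩, hg⟩ := Dense.exists_dist_lt hx y hδ
    exact ⟨g, dInfty_comm (G := G) y (g • x) ▸ h _ hg⟩
  · refine hx₀.mono ?_
    rintro _ ⟨g, rfl⟩
    exact dense_orbit_smul hx₀ g
  · obtain ⟨δ, hδ, h⟩ := (hz.of_dense_orbit hcont hx).exists_dInfty_lt hε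
    exact ⟨δ, hδ, fun y _ => h y⟩
end

section
/- Let G be a group and let (X,G) be a transitive topological dynamical system whose set of minimal points is dense in X. Then either (X,G) has sensitive dependence on initial conditions, or (X,G) is minimal and equicontinuous. -/
/-- A system `(X,G)` has sensitive dependence on initial conditions. -/
def IsSensitive (G : Type*) [Group G] (X : Type*) [MetricSpace X] [MulAction G X] : Prop :=
  ∃ ε > (0 : ℝ), ∀ U : Set X, IsOpen U → U.Nonempty →
    ∃ g : G, ε < Metric.diam ((fun z : X => g • z) '' U)

/-- The system `(X,G)` is equicontinuous. -/
def IsEqctsSys (G : Type*) [Group G] (X : Type*) [MetricSpace X] [MulAction G X] : Prop :=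
  ∀ ε > (0 : ℝ), ∃ δ > (0 : ℝ), ∀ x y : X, dist x y < δ → ∀ g : G, dist (g • x) (g • y) < ε

/-- `x` is a minimal point: its orbit closure is a minimal subsystem. -/
def IsMinimalPt (G : Type*) [Group G] {X : Type*} [MetricSpace X] [MulAction G X]
    (x : X) : Prop :=
  ∀ y ∈ closure (MulAction.orbit G x),
    closure (MulAction.orbit G y) = closure (MulAction.orbit G x)

/-- A non-sensitive system has nonempty open sets all of whose translates are uniformly small. -/
theorem exists_isOpen_dist_smul_le_of_not_isSensitive
    {G X : Type*} [Group G] [MetricSpace X] [CompactSpace X] [MulAction G X]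
    (h : ¬ IsSensitive G X) {ε : ℝ} (hε : 0 < ε) :
    ∃ U : Set X, IsOpen U ∧ U.Nonempty ∧ ∀ a ∈ U, ∀ b ∈ U, ∀ g : G, dist (g • a) (g • b) ≤ ε := by
  unfold IsSensitive at h
  push Not at h
  obtain ⟨U, hU, hne, hdiam⟩ := h ε hε
  refine ⟨U, hU, hne, fun a ha b hb g => le_trans ?_ (hdiam g)⟩
  exact Metric.dist_le_diam_of_mem (Metric.isBounded_of_compactSpace)
    (Set.mem_image_of_mem _ ha) (Set.mem_image_of_mem _ hb)

/-- If a point with dense orbit stays `ε`-close to a point of a closed invariant set along the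
whole orbit, then so does every point of the space. -/
theorem exists_mem_forall_dist_smul_le
    {G X : Type*} [Group G] [MetricSpace X] [CompactSpace X] [MulAction G X]
    (hcont : ∀ g : G, Continuous fun x : X => g • x) {x m : X}
    (hx : Dense (MulAction.orbit G x)) {ε : ℝ} {M : Set X} (hM : IsClosed M)
    (hmM : ∀ g : G, g • m ∈ M) (hxm : ∀ g : G, dist (g • x) (g • m) ≤ ε) (y : X) :
    ∃ m' ∈ M, ∀ g : G, dist (g • y) (g • m') ≤ ε := by
  have hK : IsClosed {p : X × X | p.2 ∈ M ∧ ∀ g : G, dist (g • p.1) (g • p.2) ≤ ε} := by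
    rw [show {p : X × X | p.2 ∈ M ∧ ∀ g : G, dist (g • p.1) (g • p.2) ≤ ε} =
      Prod.snd ⁻¹' M ∩ ⋂ g : G, {p : X × X | dist (g • p.1) (g • p.2) ≤ ε} by ext; simp]
    refine (hM.preimage continuous_snd).inter ?_
    exact isClosed_iInter fun g => isClosed_le
      (((hcont g).comp continuous_fst).dist ((hcont g).comp continuous_snd)) continuous_const
  have hP := (hK.isCompact.image continuous_fst).isClosed
  have hsub : MulAction.orbit G x ⊆
      Prod.fst '' {p : X × X | p.2 ∈ M ∧ ∀ g : G, dist (g • p.1) (g • p.2) ≤ ε} := by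
    rintro _ ⟨k, rfl⟩
    refine ⟨(k • x, k • m), ⟨hmM k, fun g => ?_⟩, rfl⟩
    simpa only [smul_smul] using hxm (g * k)
  obtain ⟨⟨_, m'⟩, ⟨hm', hd⟩, rfl⟩ := closure_minimal hsub hP (hx y)
  exact ⟨m', hm', hd⟩

/-- In a non-sensitive system with dense minimal points, a point with dense orbit lies in every
orbit closure. -/
theorem mem_closure_orbit_of_not_isSensitive
    {G X : Type*} [Group G] [MetricSpace X] [CompactSpace X] [MulAction G X]
    (hcont : ∀ g : G, Continuous fun x : X => g • x)
    (hdense : Dense {x : X | IsMinimalPt G x}) (h : ¬ IsSensitive G X) {x : X}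
    (hx : Dense (MulAction.orbit G x)) (y : X) : x ∈ closure (MulAction.orbit G y) := by
  refine Metric.mem_closure_iff.2 fun ε hε => ?_
  obtain ⟨U, hU, hne, hdist⟩ :=
    exists_isOpen_dist_smul_le_of_not_isSensitive h (show 0 < ε / 3 by positivity)
  obtain ⟨m, hmU, hm⟩ := hdense.inter_open_nonempty U hU hne
  obtain ⟨_, hgU, g, rfl⟩ := hx.inter_open_nonempty U hU hne
  have hgx : Dense (MulAction.orbit G (g • x)) := by rwa [MulAction.orbit_smul]
  obtain ⟨m', hm', hd⟩ := exists_mem_forall_dist_smul_le hcont hgx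
    (isClosed_closure (s := MulAction.orbit G m))
    (fun k => subset_closure (MulAction.mem_orbit m k)) (hdist _ hgU _ hmU) y
  have hmm' : m ∈ closure (MulAction.orbit G m') := by
    rw [hm m' hm']
    exact subset_closure (MulAction.mem_orbit_self m)
  obtain ⟨_, hkU, k, rfl⟩ := mem_closure_iff.1 hmm' U hU hmU
  refine ⟨(g⁻¹ * k) • y, MulAction.mem_orbit _ _, ?_⟩
  have h₁ : dist x ((g⁻¹ * k) • m') ≤ ε / 3 := by
    simpa [mul_smul] using hdist _ hgU _ hkU g⁻¹
  have h₂ := hd (g⁻¹ * k)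
  have h₃ := dist_triangle_right x ((g⁻¹ * k) • y) ((g⁻¹ * k) • m')
  linarith

/-- A non-sensitive system all of whose orbits are dense is equicontinuous. -/
theorem isEqctsSys_of_not_isSensitive
    {G X : Type*} [Group G] [MetricSpace X] [CompactSpace X] [MulAction G X]
    (hcont : ∀ g : G, Continuous fun x : X => g • x)
    (hmin : ∀ x : X, Dense (MulAction.orbit G x)) (h : ¬ IsSensitive G X) :
    IsEqctsSys G X := by
  intro ε hε
  obtain ⟨U, hU, hne, hdist⟩ := exists_isOpen_dist_smul_le_of_not_isSensitive h (half_pos hε)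
  obtain ⟨δ, hδ, hball⟩ := lebesgue_number_lemma_of_metric
    (c := fun g : G => (fun z : X => g • z) ⁻¹' U) isCompact_univ
    (fun g => hU.preimage (hcont g)) (fun x _ => by
      obtain ⟨_, hgU, g, rfl⟩ := (hmin x).inter_open_nonempty U hU hne
      exact Set.mem_iUnion.2 ⟨g, hgU⟩)
  refine ⟨δ, hδ, fun x y hxy g => ?_⟩
  obtain ⟨k, hk⟩ := hball x (Set.mem_univ x)
  have hd := hdist _ (hk (Metric.mem_ball_self hδ)) _ (hk (Metric.mem_ball'.2 hxy)) (g * k⁻¹)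
  simp only [smul_smul, inv_mul_cancel_right] at hd
  linarith

/-- A transitive system with a dense set of minimal points is either sensitive, or
minimal and equicontinuous. -/
theorem dense_minimal_points_dichotomy
    {G X : Type*} [Group G] [MetricSpace X] [CompactSpace X] [MulAction G X]
    (hcont : ∀ g : G, Continuous fun x : X => g • x)
    (htrans : ∃ x : X, Dense (MulAction.orbit G x))
    (hdense : Dense {x : X | IsMinimalPt G x}) :
    IsSensitive G X ∨ ((∀ x : X, Dense (MulAction.orbit G x)) ∧ IsEqctsSys G X) := by
  refine or_iff_not_imp_left.2 fun h => ?_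
  obtain ⟨x, hx⟩ := htrans
  have hmin : ∀ y : X, Dense (MulAction.orbit G y) := fun y =>
    dense_closure.1 <| hx.mono <| by
      rintro _ ⟨g, rfl⟩
      exact mem_closure_orbit_of_not_isSensitive hcont hdense h
        (by simpa only [MulAction.orbit_smul] using hx) y
  exact ⟨hmin, isEqctsSys_of_not_isSensitive hcont hmin h⟩
end

section
/- Let (X,G) be a topological dynamical system and let x be an equicontinuous point. If x is the limit of a sequence of minimal points x_n, then x is a minimal point. -/
open MulAction in
/-- Orbit closures are monotone: they contain the orbit closure of each of their points. -/
theorem closure_orbit_subset_of_mem_closure_orbit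
    {G X : Type*} [Group G] [TopologicalSpace X] [MulAction G X]
    (hcont : ∀ g : G, Continuous fun x : X => g • x) {x y : X}
    (hy : y ∈ closure (orbit G x)) : closure (orbit G y) ⊆ closure (orbit G x) := by
  refine closure_minimal ?_ isClosed_closure
  rintro _ ⟨g, rfl⟩
  refine map_mem_closure (hcont g) hy ?_
  rintro _ ⟨h, rfl⟩
  exact ⟨g * h, mul_smul g h x⟩

open MulAction in
/-- If the orbits of `x` and `w` stay `ε`-close, then every point of the orbit closure of `x`
is shadowed up to `ε` by a point of the orbit closure of `w`. -/
theorem exists_mem_closure_orbit_forall_dist_smul_le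
    {G X : Type*} [Group G] [MetricSpace X] [CompactSpace X] [MulAction G X]
    (hcont : ∀ g : G, Continuous fun x : X => g • x) {x w y : X} {ε : ℝ}
    (hxw : ∀ g : G, dist (g • x) (g • w) ≤ ε) (hy : y ∈ closure (orbit G x)) :
    ∃ z ∈ closure (orbit G w), ∀ g : G, dist (g • y) (g • z) ≤ ε := by
  set S : Set (X × X) := Set.range fun g : G => (g • x, g • w)
  have hfst : closure (orbit G x) ⊆ Prod.fst '' closure S := by
    refine closure_minimal ?_ (isClosed_closure.isCompact.image continuous_fst).isClosed
    rintro _ ⟨g, rfl⟩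
    exact ⟨(g • x, g • w), subset_closure ⟨g, rfl⟩, rfl⟩
  obtain ⟨⟨_, z⟩, hz, rfl⟩ := hfst hy
  refine ⟨z, map_mem_closure continuous_snd hz ?_, fun g => ?_⟩
  · rintro _ ⟨g, rfl⟩
    exact ⟨g, rfl⟩
  · have hclosed : IsClosed {p : X × X | dist (g • p.1) (g • p.2) ≤ ε} :=
      isClosed_le (((hcont g).comp continuous_fst).dist ((hcont g).comp continuous_snd))
        continuous_const
    refine closure_minimal ?_ hclosed hz
    rintro _ ⟨h, rfl⟩
    simpa only [Set.mem_ofPred_eq, mul_smul] using hxw (g * h)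

/-- An equicontinuous point which is a limit of minimal points is minimal. -/
theorem eqctsPt_limit_of_minimal_is_minimal
    {G X : Type*} [Group G] [MetricSpace X] [CompactSpace X] [MulAction G X]
    (hcont : ∀ g : G, Continuous fun x : X => g • x)
    {x : X} (hx : IsEqctsPt G x) (xs : ℕ → X)
    (hmin : ∀ n : ℕ, IsMinimalPt G (xs n))
    (hlim : Filter.Tendsto xs Filter.atTop (nhds x)) :
    IsMinimalPt G x := by
  intro y hy
  refine (closure_orbit_subset_of_mem_closure_orbit hcont hy).antisymm
    (closure_orbit_subset_of_mem_closure_orbit hcont (Metric.mem_closure_iff.2 fun ε hε => ?_))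
  obtain ⟨δ, hδ, hxδ⟩ := hx (ε / 3) (by positivity)
  obtain ⟨n, hn⟩ := (hlim.eventually (Metric.ball_mem_nhds x hδ)).exists
  have hclose : ∀ g : G, dist (g • x) (g • xs n) < ε / 3 := hxδ _ (Metric.mem_ball'.1 hn)
  obtain ⟨z, hz, hyz⟩ :=
    exists_mem_closure_orbit_forall_dist_smul_le hcont (fun g => (hclose g).le) hy
  have hmem : xs n ∈ closure (MulAction.orbit G z) :=
    hmin n z hz ▸ subset_closure (MulAction.mem_orbit_self _)
  obtain ⟨_, ⟨g, rfl⟩, hg⟩ := Metric.mem_closure_iff.1 hmem (ε / 3) (by positivity)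
  refine ⟨g • y, ⟨g, rfl⟩, ?_⟩
  have hxn : dist x (xs n) < ε / 3 := by simpa using hclose 1
  have hzy : dist (g • z) (g • y) ≤ ε / 3 := dist_comm (g • y) (g • z) ▸ hyz g
  have hg' : dist (xs n) (g • z) < ε / 3 := hg
  linarith [dist_triangle4 x (xs n) (g • z) (g • y)]
end
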